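/- Dual formulation of the regret lower bound: for every reward distribution P ∈ 𝒫, C(P) equals the infimum of Σ_{x∈X̃(P)} η(x)·Δ(x,P) over all η ≥ 0 and all collections (μ(x))_{x∈X} with μ(x) ∈ ℝ_+ × ℝ × 𝒦* for each x ∈ X, subject to the constraints 1 ≤ Dual(η,x,P;μ(x)) for every deceitful arm x ∈ X̃_d(P). -/

import Mathlib

open scoped BigOperators Classical
open Filter

namespace Bandit

/-- Matrices indexed by rewards and arms; a reward distribution is such a matrix. -/
abbrev RMat (R X : Type*) := R → X → ℝ

section Core

variable {R X : Type*} [Fintype R] [Fintype X] [Nonempty X]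

/-- The set `𝒫_Ω` of all reward distributions. -/
def POmega : Set (RMat R X) :=
  {Q | (∀ r x, 0 ≤ Q r x) ∧ ∀ x : X, ∑ r : R, Q r x = 1}

/-- The interior of `T` in the topology relative to `S`. -/
def relIntIn (S T : Set (RMat R X)) : Set (RMat R X) :=
  {Q | Q ∈ T ∧ ∃ U : Set (RMat R X), IsOpen U ∧ Q ∈ U ∧ U ∩ S ⊆ T}

/-- Information distance `I(M', M)` between two nonnegative measures on a finite set. -/
noncomputable def infoDiv {α : Type*} [Fintype α] (M' M : α → ℝ) : EReal :=
  if ∀ a, M a = 0 → M' a = 0 then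
    ((∑ a : α, (M' a * Real.log (M' a / M a) - M' a + M a) : ℝ) : EReal)
  else ⊤

/-- Expected reward of arm `x` under reward distribution `Q` (reward values `v`). -/
def rewOf (v : R → ℝ) (Q : RMat R X) (x : X) : ℝ := ∑ r : R, v r * Q r x

/-- Optimal expected reward `Rew*`. -/
noncomputable def rewStar (v : R → ℝ) (Q : RMat R X) : ℝ :=
  Finset.univ.sup' Finset.univ_nonempty (rewOf v Q)

/-- The set `x*(Q)` of optimal arms. -/
def optArms (v : R → ℝ) (Q : RMat R X) : Set X := {x | rewOf v Q x = rewStar v Q}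

/-- The set `X̃(Q)` of suboptimal arms. -/
def subArms (v : R → ℝ) (Q : RMat R X) : Set X := {x | rewOf v Q x ≠ rewStar v Q}

noncomputable def optFinset (v : R → ℝ) (Q : RMat R X) : Finset X :=
  Finset.univ.filter fun x => rewOf v Q x = rewStar v Q

noncomputable def subFinset (v : R → ℝ) (Q : RMat R X) : Finset X :=
  Finset.univ.filter fun x => rewOf v Q x ≠ rewStar v Q

/-- The suboptimality gap `Δ(x, Q)`. -/
noncomputable def gapOf (v : R → ℝ) (Q : RMat R X) (x : X) : ℝ := rewStar v Q - rewOf v Q x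

/-- The set `Deceit(x', P)` of deceitful reward distributions. -/
def DeceitSet (v : R → ℝ) (PP : Set (RMat R X)) (x' : X) (P : RMat R X) :
    Set (RMat R X) :=
  {Q | Q ∈ PP ∧ (∀ x ∈ optArms v P, ∀ r, Q r x = P r x) ∧
    ∀ x ∈ optArms v P, rewOf v Q x < rewOf v Q x'}

/-- The objective `Σ_{x ∈ X̃(P)} η(x)·I(P(x), Q(x))`. -/
noncomputable def distObj (v : R → ℝ) (η : X → ℝ) (P Q : RMat R X) : EReal :=
  ∑ x ∈ subFinset v P, ((η x : ℝ) : EReal) * infoDiv (fun r => P r x) (fun r => Q r x)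

/-- The distance function `Dist(η, x', P)` (equal to `⊤` if `Deceit(x', P)` is empty). -/
noncomputable def DistFn (v : R → ℝ) (PP : Set (RMat R X)) (η : X → ℝ) (x' : X)
    (P : RMat R X) : EReal :=
  sInf (distObj v η P '' DeceitSet v PP x' P)

/-- The regret lower bound `C(P)`. -/
noncomputable def CFn (v : R → ℝ) (PP : Set (RMat R X)) (P : RMat R X) : EReal :=
  sInf {c : EReal | ∃ η : X → ℝ, (∀ x, 0 ≤ η x) ∧
    (∀ x ∈ subArms v P, 1 ≤ DistFn v PP η x P) ∧
    c = ((∑ x ∈ subFinset v P, η x * gapOf v P x : ℝ) : EReal)}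

/-- The maximal reward `Rew_max(x', P)` of arm `x'`. -/
noncomputable def rewMax (v : R → ℝ) (PP : Set (RMat R X)) (x' : X) (P : RMat R X) : ℝ :=
  sSup {c : ℝ | ∃ Q ∈ PP, (∀ x ∈ optArms v P, ∀ r, Q r x = P r x) ∧ c = rewOf v Q x'}

/-- The set `X̃_d(P)` of deceitful arms. -/
def deceitArms (v : R → ℝ) (PP : Set (RMat R X)) (P : RMat R X) : Set X :=
  {x | x ∈ subArms v P ∧ rewStar v P < rewMax v PP x P}

/-- The conic hull `𝒦 = cone(𝒫)`. -/
def coneP (PP : Set (RMat R X)) : Set (RMat R X) :=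
  {Q | ∃ θ : ℝ, 0 ≤ θ ∧ ∃ Q' ∈ PP, Q = θ • Q'}

/-- The dual cone `𝒦*`. -/
def dualConeP (PP : Set (RMat R X)) : Set (RMat R X) :=
  {l | ∀ Q ∈ coneP PP, 0 ≤ ∑ x : X, ∑ r : R, l r x * Q r x}

/-- Extended-real logarithm (with `elog t = ⊥` for `t ≤ 0`). -/
noncomputable def elog (t : ℝ) : EReal := if 0 < t then ((Real.log t : ℝ) : EReal) else ⊥

/-- The dual function `Dual(η, x', Q; μ)` for `μ = (α, β, λ)`. -/
noncomputable def dualFn (v : R → ℝ) (η : X → ℝ) (x' : X) (Q : RMat R X)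
    (α β : ℝ) (l : RMat R X) : EReal :=
  if ∀ x ∈ subFinset v Q, ∀ r : R,
      0 ≤ η x - l r x - β - α * v r * (if x = x' then 1 else 0) then
    (∑ x ∈ subFinset v Q, ∑ r : R,
      ((η x * Q r x : ℝ) : EReal) *
        elog ((η x - l r x - β - α * v r * (if x = x' then 1 else 0)) / η x)) +
    ((-(∑ x ∈ optFinset v Q, ∑ r : R, l r x * Q r x) + α * rewStar v Q +
        β * ((subFinset v Q).card : ℝ) : ℝ) : EReal)
  else ⊥

/-- The set `𝒫'` of reward distributions satisfying Assumption 1. -/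
def PPrime (v : R → ℝ) (PP : Set (RMat R X)) : Set (RMat R X) :=
  {P | P ∈ PP ∧ (∃ x₀ : X, optArms v P = {x₀}) ∧
    (∀ x : X, rewMax v PP x P ≠ rewStar v P) ∧ P ∈ relIntIn POmega PP}

/-- The dual-test function `Dualbar(η, x', Q; μ) = max_{ρ ≥ 0} Dual(η, x', Q; ρ·μ)`. -/
noncomputable def dualTest (v : R → ℝ) (η : X → ℝ) (x' : X) (Q : RMat R X)
    (μ : ℝ × ℝ × RMat R X) : EReal :=
  sSup {d : EReal | ∃ ρ : ℝ, 0 ≤ ρ ∧ d = dualFn v η x' Q (ρ * μ.1) (ρ * μ.2.1) (ρ • μ.2.2)}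

end Core

end Bandit

namespace Bandit

section Duality

variable {R X : Type*} [Fintype R] [Fintype X]

lemma linearMap_apply_eq_sum (φ : RMat R X →ₗ[ℝ] ℝ) (M : RMat R X) :
    φ M = ∑ x, ∑ r, φ (Pi.single r (Pi.single x 1)) * M r x := by
  have hM : M = ∑ x, ∑ r, M r x • (Pi.single r (Pi.single x 1) : RMat R X) := by
    ext r x
    simp [Finset.sum_apply, Pi.single_apply, apply_ite]
  conv_lhs => rw [hM]
  simp [mul_comm]

/-- Lagrange multipliers, up to `ε`, for minimizing a linear functional `k` over the members of a
compact convex set of reward distributions that agree with `P` outside `S` and satisfy `b ≤ h`. -/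
lemma exists_multipliers {PP : Set (RMat R X)} (hsub : PP ⊆ POmega) (hconv : Convex ℝ PP)
    (hcomp : IsCompact PP) {P : RMat R X} (hP : P ∈ PP) (S : Finset X) {x₀ : X} (hx₀ : x₀ ∉ S)
    (h k : RMat R X →ₗ[ℝ] ℝ) (b : ℝ)
    (hfeas : ∃ Q ∈ PP, (∀ x ∉ S, ∀ r, Q r x = P r x) ∧ b ≤ h Q)
    (hmin : ∀ Q ∈ PP, (∀ x ∉ S, ∀ r, Q r x = P r x) → b ≤ h Q → 0 ≤ k Q)
    {ε : ℝ} (hε : 0 < ε) :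
    ∃ α : ℝ, 0 ≤ α ∧ ∃ y : RMat R X,
      (∀ Q ∈ PP, 0 ≤ k Q - α * h Q + ∑ x ∈ Sᶜ, ∑ r, y r x * Q r x) ∧
      -ε ≤ α * b - ∑ x ∈ Sᶜ, ∑ r, y r x * P r x := by
  let ρ : RMat R X →ₗ[ℝ] RMat R X :=
    { toFun := fun Q r x => if x ∈ S then 0 else Q r x
      map_add' := fun Q Q' => by ext r x; by_cases hx : x ∈ S <;> simp [hx]
      map_smul' := fun c Q => by ext r x; by_cases hx : x ∈ S <;> simp [hx] }
  let A : RMat R X →ₗ[ℝ] RMat R X × ℝ × ℝ := ρ.prod (h.prod k)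
  have hA : Continuous A := A.continuous_of_finiteDimensional
  have hTconv : Convex ℝ (({ρ P} : Set (RMat R X)) ×ˢ (Set.Ici b ×ˢ Set.Iic (-ε))) :=
    (convex_singleton _).prod ((convex_Ici b).prod (convex_Iic _))
  have hTclosed : IsClosed (({ρ P} : Set (RMat R X)) ×ˢ (Set.Ici b ×ˢ Set.Iic (-ε))) :=
    isClosed_singleton.prod (isClosed_Ici.prod isClosed_Iic)
  have hdisj : Disjoint (A '' PP) (({ρ P} : Set (RMat R X)) ×ˢ (Set.Ici b ×ˢ Set.Iic (-ε))) := by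
    rw [Set.disjoint_left]
    rintro _ ⟨Q, hQ, rfl⟩ ⟨h1, h2, h3⟩
    have h1' : ρ Q = ρ P := h1
    have hagree : ∀ x ∉ S, ∀ r, Q r x = P r x := by
      intro x hx r
      have := congrFun (congrFun h1' r) x
      simpa [ρ, hx] using this
    have h4 := hmin Q hQ hagree h2
    have h5 : k Q ≤ -ε := h3
    linarith
  obtain ⟨φ, u, w, hu, huw, hw⟩ := geometric_hahn_banach_compact_closed
    (hconv.linear_image A) (hcomp.image hA) hTconv hTclosed hdisj
  set Y : RMat R X →ₗ[ℝ] ℝ := φ.toLinearMap ∘ₗ LinearMap.inl ℝ _ _ with hY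
  set a : ℝ := φ (0, 1, 0) with ha
  set c : ℝ := φ (0, 0, 1) with hc
  have hφ : ∀ (M : RMat R X) (t s : ℝ), φ (M, t, s) = Y M + a * t + c * s := by
    intro M t s
    have : ((M, t, s) : RMat R X × ℝ × ℝ) = (M, 0, 0) + t • (0, 1, 0) + s • (0, 0, 1) := by
      simp
    rw [this, map_add, map_add, map_smul, map_smul]
    simp only [hY, ha, hc, smul_eq_mul, mul_comm]
    rfl
  have hlow : ∀ Q ∈ PP, Y (ρ Q) + a * h Q + c * k Q < u := fun Q hQ => by
    rw [← hφ]; exact hu _ ⟨Q, hQ, rfl⟩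
  have hup : ∀ t s, b ≤ t → s ≤ -ε → w < Y (ρ P) + a * t + c * s := fun t s ht hs => by
    rw [← hφ]; exact hw _ ⟨rfl, ht, hs⟩
  have hc0 : c < 0 := by
    obtain ⟨Q, hQ, hag, hb⟩ := hfeas
    have h1 := hlow Q hQ
    have h2 := hup (h Q) (-ε) hb le_rfl
    have h3 := hmin Q hQ hag hb
    have h4 : ρ Q = ρ P := by
      ext r x
      by_cases hx : x ∈ S
      · simp [ρ, hx]
      · simp [ρ, hx, hag x hx r]
    rw [h4] at h1
    by_contra hcn
    push Not at hcn
    nlinarith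
  have ha0 : 0 ≤ a := by
    by_contra han
    push Not at han
    have h1 := hup b (-ε) le_rfl le_rfl
    have h2 := hup (b + (w - Y (ρ P) + c * ε - a * b) / a) (-ε)
      (by
        have : 0 ≤ (w - Y (ρ P) + c * ε - a * b) / a :=
          div_nonneg_of_nonpos (by linarith) han.le
        linarith) le_rfl
    rw [mul_add, mul_div_cancel₀ _ han.ne] at h2
    linarith
  set d : ℝ := -c with hd
  have hd0 : 0 < d := by linarith
  have hsum : ∀ Q ∈ PP, ∑ x ∈ Sᶜ, ∑ r, (-(Y (Pi.single r (Pi.single x 1))) / d +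
      (if x = x₀ then u / d else 0)) * Q r x = -Y (ρ Q) / d + u / d := by
    intro Q hQ
    simp only [add_mul, Finset.sum_add_distrib]
    congr 1
    · have hin : ∑ x ∈ S, ∑ r, Y (Pi.single r (Pi.single x 1)) * ρ Q r x = 0 :=
        Finset.sum_eq_zero fun x hx => Finset.sum_eq_zero fun r _ => by simp [ρ, hx]
      rw [linearMap_apply_eq_sum Y (ρ Q), ← Finset.sum_compl_add_sum S, hin, add_zero, neg_div,
        Finset.sum_div, ← Finset.sum_neg_distrib]
      refine Finset.sum_congr rfl fun x hx => ?_
      rw [Finset.sum_div, ← Finset.sum_neg_distrib]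
      refine Finset.sum_congr rfl fun r _ => ?_
      have hx' : x ∉ S := Finset.mem_compl.1 hx
      simp only [ρ, LinearMap.coe_mk, AddHom.coe_mk, hx', if_false]
      ring
    · have : ∀ x ∈ Sᶜ, ∑ r, (if x = x₀ then u / d else 0) * Q r x =
          if x = x₀ then u / d else 0 := by
        intro x _
        rw [← Finset.mul_sum, (hsub hQ).2 x, mul_one]
      rw [Finset.sum_congr rfl this]
      simp [hx₀]
  refine ⟨a / d, by positivity, fun r x => -(Y (Pi.single r (Pi.single x 1))) / d +
      (if x = x₀ then u / d else 0), fun Q hQ => ?_, ?_⟩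
  · rw [hsum Q hQ]
    have := hlow Q hQ
    have h2 : k Q - a / d * h Q + (-Y (ρ Q) / d + u / d)
        = (u - (Y (ρ Q) + a * h Q + c * k Q)) / d := by
      rw [show c = -d by simp [hd]]
      field_simp
      ring
    rw [h2]
    exact div_nonneg (by linarith) hd0.le
  · rw [hsum P hP]
    have := hup b (-ε) le_rfl le_rfl
    have h2 : a / d * b - (-Y (ρ P) / d + u / d) + ε
        = ((Y (ρ P) + a * b + c * (-ε)) - u) / d := by
      rw [show c = -d by simp [hd]]
      field_simp
      ring
    have h3 : 0 ≤ ((Y (ρ P) + a * b + c * (-ε)) - u) / d := div_nonneg (by linarith) hd0.le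
    linarith

/-- First-order optimality in the direction of `Q` for a maximizer `Q'` of a weighted
log-likelihood. -/
lemma sum_mul_div_le_of_isMax {ι : Type*} (T : Finset ι) (c q q' : ι → ℝ)
    (hq' : ∀ i ∈ T, c i ≠ 0 → 0 < q' i)
    (hmax : ∀ᶠ s in nhdsWithin (0 : ℝ) (Set.Ioi 0),
      ∑ i ∈ T, c i * Real.log (q' i + s * (q i - q' i)) ≤ ∑ i ∈ T, c i * Real.log (q' i)) :
    ∑ i ∈ T, c i * (q i - q' i) / q' i ≤ 0 := by
  have hder : HasDerivAt (fun s : ℝ => ∑ i ∈ T, c i * Real.log (q' i + s * (q i - q' i)))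
      (∑ i ∈ T, c i * (q i - q' i) / q' i) 0 := by
    apply HasDerivAt.fun_sum
    intro i hi
    by_cases hc : c i = 0
    · simpa [hc] using hasDerivAt_const (0 : ℝ) (0 : ℝ)
    · have h1 : HasDerivAt (fun s : ℝ => q' i + s * (q i - q' i)) (q i - q' i) 0 := by
        simpa using ((hasDerivAt_id (0 : ℝ)).mul_const (q i - q' i)).const_add (q' i)
      have h2 := (h1.log (by simpa using (hq' i hi hc).ne')).const_mul (c i)
      simpa [mul_div_assoc] using h2
  have ht := hder.tendsto_slope_zero_right
  refine le_of_tendsto ht ?_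
  filter_upwards [hmax, self_mem_nhdsWithin] with s hs hs0
  have hs0' : (0 : ℝ) < s := hs0
  simp only [zero_add, zero_mul, add_zero, smul_eq_mul]
  exact mul_nonpos_of_nonneg_of_nonpos (by positivity) (by linarith)

lemma ereal_coe_sum {ι : Type*} (s : Finset ι) (f : ι → ℝ) :
    ((∑ i ∈ s, f i : ℝ) : EReal) = ∑ i ∈ s, (f i : EReal) :=
  map_sum (⟨⟨Real.toEReal, EReal.coe_zero⟩, EReal.coe_add⟩ : ℝ →+ EReal) f s

lemma mul_elog_add_le {a p q s : ℝ} (ha : 0 < a) (hp : 0 ≤ p) (hq : 0 ≤ q) (hpq : q = 0 → p = 0)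
    (hs : 0 ≤ a - s) :
    ((a * p : ℝ) : EReal) * elog ((a - s) / a) + ((s * q : ℝ) : EReal) ≤
      ((a * (p * Real.log (p / q) - p + q) : ℝ) : EReal) := by
  rcases hp.eq_or_lt with rfl | hp
  · simp only [mul_zero, EReal.coe_zero, zero_mul, zero_add, sub_zero, EReal.coe_le_coe_iff]
    nlinarith
  have hq : 0 < q := lt_of_le_of_ne hq fun h => hp.ne' (hpq h.symm)
  rcases hs.eq_or_lt with hs | hs
  · rw [← hs, zero_div, elog, if_neg (lt_irrefl _), EReal.coe_mul_bot_of_pos (by positivity)]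
    simp
  · rw [elog, if_pos (by positivity), ← EReal.coe_mul, ← EReal.coe_add, EReal.coe_le_coe_iff]
    have h1 : Real.log ((a - s) / a / (p / q)) ≤ (a - s) / a / (p / q) - 1 :=
      Real.log_le_sub_one_of_pos (by positivity)
    rw [Real.log_div (by positivity) (by positivity)] at h1
    have h2 := mul_le_mul_of_nonneg_left h1 (show 0 ≤ a * p by positivity)
    have h3 : a * p * ((a - s) / a / (p / q) - 1) = (a - s) * q - a * p := by
      field_simp
    rw [h3] at h2
    linarith

lemma sum_mul_elog_add_le {a : ℝ} {p q s : R → ℝ} (ha : 0 ≤ a) (hp : ∀ r, 0 ≤ p r)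
    (hq : ∀ r, 0 ≤ q r) (hs : ∀ r, 0 ≤ a - s r) :
    ∑ r, ((a * p r : ℝ) : EReal) * elog ((a - s r) / a) + ∑ r, ((s r * q r : ℝ) : EReal) ≤
      (a : EReal) * infoDiv p q := by
  rcases ha.eq_or_lt with rfl | ha
  · simp only [zero_mul, EReal.coe_zero, Finset.sum_const_zero, zero_add]
    refine Finset.sum_nonpos fun r _ => ?_
    have := hs r
    exact_mod_cast mul_nonpos_of_nonpos_of_nonneg (by linarith) (hq r)
  · rw [infoDiv]
    split_ifs with h
    · rw [← EReal.coe_mul, Finset.mul_sum, ereal_coe_sum, ← Finset.sum_add_distrib]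
      exact Finset.sum_le_sum fun r _ => mul_elog_add_le ha (hp r) (hq r) (h r) (hs r)
    · rw [EReal.coe_mul_top_of_pos ha]
      exact le_top

end Duality

section Reward

variable {R X : Type*} [Fintype R]

lemma rewOf_lineMap (v : R → ℝ) (Q Q' : RMat R X) (t : ℝ) (x : X) :
    rewOf v ((1 - t) • Q + t • Q') x = (1 - t) * rewOf v Q x + t * rewOf v Q' x := by
  simp only [rewOf, Finset.mul_sum, ← Finset.sum_add_distrib]
  refine Finset.sum_congr rfl fun r _ => ?_
  simp only [Pi.add_apply, Pi.smul_apply, smul_eq_mul]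
  ring

lemma continuous_rewOf (v : R → ℝ) (x : X) : Continuous fun Q : RMat R X => rewOf v Q x := by
  unfold rewOf
  fun_prop

end Reward

section Bandits

variable {R X : Type*} [Fintype R] [Fintype X] [Nonempty X]

lemma optFinset_eq_compl (v : R → ℝ) (P : RMat R X) : optFinset v P = (subFinset v P)ᶜ := by
  ext x; simp [optFinset, subFinset]

lemma notMem_subFinset {v : R → ℝ} {P : RMat R X} {x : X} :
    x ∉ subFinset v P ↔ x ∈ optArms v P := by
  simp [subFinset, optArms]

lemma optArms_nonempty (v : R → ℝ) (P : RMat R X) : (optArms v P).Nonempty := by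
  obtain ⟨x, -, hx⟩ := Finset.exists_mem_eq_sup' Finset.univ_nonempty (rewOf v P)
  exact ⟨x, hx.symm⟩

lemma rewOf_lt_rewStar {v : R → ℝ} {P : RMat R X} {x : X} (hx : x ∈ subArms v P) :
    rewOf v P x < rewStar v P :=
  lt_of_le_of_ne (Finset.le_sup' (rewOf v P) (Finset.mem_univ x)) hx

/-- Weak duality. -/
lemma dualFn_le_distObj {v : R → ℝ} {PP : Set (RMat R X)} (hsub : PP ⊆ POmega) {P : RMat R X}
    (hP : P ∈ PP) {η : X → ℝ} (hη : ∀ x, 0 ≤ η x) {x' : X} (hx' : x' ∈ subArms v P)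
    {α β : ℝ} (hα : 0 ≤ α) {l : RMat R X} (hl : l ∈ dualConeP PP) {Q : RMat R X}
    (hQ : Q ∈ DeceitSet v PP x' P) :
    dualFn v η x' P α β l ≤ distObj v η P Q := by
  obtain ⟨hQP, hag, hrew⟩ := hQ
  rw [dualFn]
  split_ifs with hs
  swap
  · exact bot_le
  set S := subFinset v P with hS
  have hx'S : x' ∈ S := by simpa [hS, subFinset, subArms] using hx'
  let s : X → R → ℝ := fun x r => l r x + β + α * v r * (if x = x' then 1 else 0)
  have hs' : ∀ x r, η x - l r x - β - α * v r * (if x = x' then 1 else 0) = η x - s x r :=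
    fun x r => by simp only [s]; ring
  simp only [hs'] at hs ⊢
  have h1 : ∑ x ∈ S, (∑ r, ((η x * P r x : ℝ) : EReal) * elog ((η x - s x r) / η x) +
      ∑ r, ((s x r * Q r x : ℝ) : EReal)) ≤ distObj v η P Q :=
    Finset.sum_le_sum fun x hx => sum_mul_elog_add_le (hη x) (fun r => (hsub hP).1 r x)
      (fun r => (hsub hQP).1 r x) (hs x hx)
  rw [Finset.sum_add_distrib] at h1
  refine le_trans (add_le_add le_rfl ?_) h1
  simp only [← ereal_coe_sum]
  rw [EReal.coe_le_coe_iff]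
  have hlQ : 0 ≤ ∑ x, ∑ r, l r x * Q r x := hl Q ⟨1, zero_le_one, Q, hQP, by simp⟩
  rw [← Finset.sum_compl_add_sum S] at hlQ
  have hopt : ∑ x ∈ optFinset v P, ∑ r, l r x * P r x = ∑ x ∈ Sᶜ, ∑ r, l r x * Q r x := by
    rw [optFinset_eq_compl]
    refine Finset.sum_congr rfl fun x hx => Finset.sum_congr rfl fun r _ => ?_
    rw [hag x (notMem_subFinset.1 (Finset.mem_compl.1 hx)) r]
  have hrew' : rewStar v P ≤ rewOf v Q x' := by
    obtain ⟨x₀, hx₀⟩ := optArms_nonempty v P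
    have h2 := hrew x₀ hx₀
    have h3 : rewOf v Q x₀ = rewOf v P x₀ := by simp [rewOf, hag x₀ hx₀]
    have h4 : rewOf v P x₀ = rewStar v P := hx₀
    linarith
  have hsplit : ∑ x ∈ S, ∑ r, s x r * Q r x =
      ∑ x ∈ S, ∑ r, l r x * Q r x + β * S.card + α * rewOf v Q x' := by
    have hx : ∀ x ∈ S, ∑ r, s x r * Q r x = ∑ r, l r x * Q r x + β +
        if x = x' then α * rewOf v Q x' else 0 := by
      intro x _
      simp only [s, add_mul, Finset.sum_add_distrib]
      rw [← Finset.mul_sum, (hsub hQP).2 x, mul_one]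
      congr 1
      split_ifs with h
      · subst h
        simp [rewOf, Finset.mul_sum, mul_assoc]
      · simp
    rw [Finset.sum_congr rfl hx]
    simp [Finset.sum_add_distrib, hx'S, mul_comm]
  rw [hopt, hsplit]
  nlinarith [mul_le_mul_of_nonneg_left hrew' hα]

/-- The real-valued weighted divergence, equal to `distObj` at points dominating `P`. -/
noncomputable def realDist (v : R → ℝ) (η : X → ℝ) (P Q : RMat R X) : ℝ :=
  ∑ x ∈ subFinset v P, η x * ∑ r, (P r x * Real.log (P r x / Q r x) - P r x + Q r x)

lemma distObj_eq_realDist {v : R → ℝ} {η : X → ℝ} {P Q : RMat R X}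
    (h : ∀ x ∈ subFinset v P, ∀ r, Q r x = 0 → P r x = 0) :
    distObj v η P Q = (realDist v η P Q : EReal) := by
  rw [distObj, realDist, ereal_coe_sum]
  refine Finset.sum_congr rfl fun x hx => ?_
  rw [infoDiv, if_pos (h x hx), EReal.coe_mul]

lemma div_log_nonneg {p q : ℝ} (hp : 0 ≤ p) (hq : 0 ≤ q) (h : q = 0 → p = 0) :
    0 ≤ p * Real.log (p / q) - p + q := by
  rcases hp.eq_or_lt with rfl | hp
  · simpa using hq
  have hq : 0 < q := lt_of_le_of_ne hq fun h' => hp.ne' (h h'.symm)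
  have h1 := Real.log_le_sub_one_of_pos (show 0 < q / p by positivity)
  have h2 : Real.log (p / q) = -Real.log (q / p) := by rw [← Real.log_inv, inv_div]
  have h3 := mul_le_mul_of_nonneg_left h1 hp.le
  have h4 : p * (q / p - 1) = q - p := by field_simp
  rw [h2]
  linarith

/-- Deceitful distributions relaxed to a non-strict reward inequality. -/
def relaxedDeceit (v : R → ℝ) (PP : Set (RMat R X)) (x' : X) (P : RMat R X) :
    Set (RMat R X) :=
  {Q | Q ∈ PP ∧ (∀ x ∈ optArms v P, ∀ r, Q r x = P r x) ∧ rewStar v P ≤ rewOf v Q x'}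

lemma exists_mem_deceitSet {v : R → ℝ} {PP : Set (RMat R X)} {P : RMat R X}
    (hP : P ∈ PP) {x' : X} (hx' : x' ∈ deceitArms v PP P) : (DeceitSet v PP x' P).Nonempty := by
  obtain ⟨c, ⟨Q, hQ, hag, rfl⟩, hc⟩ :=
    exists_lt_of_lt_csSup (by exact ⟨_, P, hP, fun _ _ _ => rfl, rfl⟩) hx'.2
  refine ⟨Q, hQ, hag, fun x hx => ?_⟩
  have h1 : rewOf v Q x = rewOf v P x := by simp [rewOf, hag x hx]
  have h2 : rewOf v P x = rewStar v P := hx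
  linarith

lemma rewStar_lt_rewOf {v : R → ℝ} {PP : Set (RMat R X)} {P Q : RMat R X} {x' : X}
    (hQ : Q ∈ DeceitSet v PP x' P) : rewStar v P < rewOf v Q x' := by
  obtain ⟨x₀, hx₀⟩ := optArms_nonempty v P
  have h2 := hQ.2.2 x₀ hx₀
  have h3 : rewOf v Q x₀ = rewOf v P x₀ := by simp [rewOf, hQ.2.1 x₀ hx₀]
  have h4 : rewOf v P x₀ = rewStar v P := hx₀
  linarith

lemma mem_deceitArms_of_mem_deceitSet {v : R → ℝ} {PP : Set (RMat R X)} (hcomp : IsCompact PP)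
    {P Q : RMat R X} {x' : X} (hx' : x' ∈ subArms v P) (hQ : Q ∈ DeceitSet v PP x' P) :
    x' ∈ deceitArms v PP P := by
  refine ⟨hx', (rewStar_lt_rewOf hQ).trans_le (le_csSup ?_ ⟨Q, hQ.1, hQ.2.1, rfl⟩)⟩
  refine (hcomp.image (continuous_rewOf v x')).bddAbove.mono ?_
  rintro _ ⟨Q, hQ, -, rfl⟩
  exact ⟨Q, hQ, rfl⟩

/-- The infimum over strictly deceitful distributions also bounds the relaxed ones. -/
lemma one_le_realDist {v : R → ℝ} {PP : Set (RMat R X)} (hsub : PP ⊆ POmega)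
    (hconv : Convex ℝ PP) {P : RMat R X} {η : X → ℝ} {x' : X}
    (hdist : 1 ≤ DistFn v PP η x' P) {Q₀ : RMat R X} (hQ₀ : Q₀ ∈ DeceitSet v PP x' P)
    {Q : RMat R X} (hQ : Q ∈ relaxedDeceit v PP x' P)
    (hpos : ∀ x ∈ subFinset v P, ∀ r, P r x ≠ 0 → 0 < Q r x) :
    1 ≤ realDist v η P Q := by
  have hcont : ContinuousAt
      (fun t : ℝ => realDist v η P ((1 - t) • Q + t • Q₀)) 0 := by
    unfold realDist
    refine tendsto_finsetSum _ fun x hx => ?_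
    refine Tendsto.const_mul _ (tendsto_finsetSum _ fun r _ => ?_)
    have hlin : ContinuousAt (fun t : ℝ => ((1 - t) • Q + t • Q₀) r x) 0 := by
      simp only [Pi.add_apply, Pi.smul_apply]
      fun_prop
    refine Tendsto.add (Tendsto.sub ?_ tendsto_const_nhds) hlin
    by_cases hP0 : P r x = 0
    · simp [hP0]
    · have hq := hpos x hx r hP0
      have : ContinuousAt (fun t : ℝ => Real.log (P r x / ((1 - t) • Q + t • Q₀) r x)) 0 :=
        (continuousAt_const.div hlin (by simpa using hq.ne')).log
          (by simpa using ⟨hP0, hq.ne'⟩)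
      exact Tendsto.const_mul _ this
  have hlim : Tendsto (fun t : ℝ => realDist v η P ((1 - t) • Q + t • Q₀))
      (nhdsWithin 0 (Set.Ioi 0)) (nhds (realDist v η P Q)) := by
    have := hcont.tendsto
    simp only [sub_zero, one_smul, zero_smul, add_zero] at this
    exact this.mono_left nhdsWithin_le_nhds
  refine ge_of_tendsto hlim ?_
  filter_upwards [Ioo_mem_nhdsGT (zero_lt_one' ℝ)] with t ht
  have hmem : (1 - t) • Q + t • Q₀ ∈ DeceitSet v PP x' P := by
    have hag : ∀ x ∈ optArms v P, ∀ r, ((1 - t) • Q + t • Q₀) r x = P r x := by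
      intro x hx r
      simp only [Pi.add_apply, Pi.smul_apply, smul_eq_mul, hQ.2.1 x hx r, hQ₀.2.1 x hx r]
      ring
    refine ⟨hconv hQ.1 hQ₀.1 (by linarith [ht.2]) ht.1.le (by ring), hag, fun x hx => ?_⟩
    have h1 : rewOf v ((1 - t) • Q + t • Q₀) x = rewOf v P x := by
      simp only [rewOf, hag x hx]
    have h2 : rewOf v P x = rewStar v P := hx
    rw [h1, h2, rewOf_lineMap]
    nlinarith [hQ.2.2, rewStar_lt_rewOf hQ₀, ht.1, ht.2]
  have hle : (1 : EReal) ≤ distObj v η P ((1 - t) • Q + t • Q₀) :=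
    hdist.trans (sInf_le ⟨_, hmem, rfl⟩)
  rw [distObj_eq_realDist] at hle
  · exact_mod_cast hle
  · intro x hx r h0
    by_contra hP0
    have h1 := hpos x hx r hP0
    have h2 := (hsub hQ₀.1).1 r x
    simp only [Pi.add_apply, Pi.smul_apply, smul_eq_mul] at h0
    nlinarith [mul_pos (sub_pos.2 ht.2) h1, mul_nonneg ht.1.le h2]

/-- The weighted likelihood attains its maximum over the relaxed deceitful distributions at a point
that dominates `P` on suboptimal arms and satisfies the first-order optimality condition. -/
lemma exists_likelihood_max {v : R → ℝ} {PP : Set (RMat R X)} (hsub : PP ⊆ POmega)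
    (hconv : Convex ℝ PP) (hcomp : IsCompact PP) {P : RMat R X} (hP : P ∈ PP) {η : X → ℝ}
    (hη : ∀ x, 0 < η x) {x' : X} (hx' : x' ∈ deceitArms v PP P) :
    ∃ Q' ∈ relaxedDeceit v PP x' P,
      (∀ x ∈ subFinset v P, ∀ r, P r x ≠ 0 → 0 < Q' r x) ∧
      ∀ Q ∈ relaxedDeceit v PP x' P,
        0 ≤ ∑ x ∈ subFinset v P, ∑ r, (η x - η x * P r x / Q' r x) * Q r x := by
  set S := subFinset v P with hS
  set F := relaxedDeceit v PP x' P with hF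
  let G : RMat R X → ℝ := fun Q => ∏ x ∈ S, ∏ r, (Q r x) ^ (η x * P r x)
  have hηP : ∀ x r, 0 ≤ η x * P r x := fun x r => mul_nonneg (hη x).le ((hsub hP).1 r x)
  have hGcont : Continuous G := by
    refine continuous_finsetProd _ fun x _ => continuous_finsetProd _ fun r _ => ?_
    exact Continuous.rpow_const (by fun_prop) fun _ => Or.inr (hηP x r)
  have hFcomp : IsCompact F := by
    have hcl : IsClosed {Q : RMat R X | (∀ x ∈ optArms v P, ∀ r, Q r x = P r x) ∧
        rewStar v P ≤ rewOf v Q x'} := by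
      refine IsClosed.and ?_ (isClosed_le continuous_const (continuous_rewOf v x'))
      simp only [Set.ofPred_forall]
      exact isClosed_iInter fun x => isClosed_iInter fun _ => isClosed_iInter fun r =>
        isClosed_eq (by fun_prop) continuous_const
    exact hcomp.inter_right hcl
  have hGpos : ∀ Q ∈ F, (∀ x ∈ S, ∀ r, P r x ≠ 0 → 0 < Q r x) → 0 < G Q := by
    intro Q _ hpos
    refine Finset.prod_pos fun x hx => Finset.prod_pos fun r _ => ?_
    by_cases hP0 : P r x = 0
    · simp [hP0]
    · exact Real.rpow_pos_of_pos (hpos x hx r hP0) _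
  obtain ⟨Q₁, hQ₁, hQ₁pos⟩ : ∃ Q ∈ F, ∀ x ∈ S, ∀ r, P r x ≠ 0 → 0 < Q r x := by
    obtain ⟨Q₀, hQ₀⟩ := exists_mem_deceitSet hP hx'
    have h1 := rewOf_lt_rewStar hx'.1
    have h2 := rewStar_lt_rewOf hQ₀
    set t := (rewStar v P - rewOf v P x') / (rewOf v Q₀ x' - rewOf v P x') with ht
    have ht0 : 0 ≤ t := div_nonneg (by linarith) (by linarith)
    have ht1 : t < 1 := (div_lt_one (by linarith)).2 (by linarith)
    have ht2 : t * (rewOf v Q₀ x' - rewOf v P x') = rewStar v P - rewOf v P x' :=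
      div_mul_cancel₀ _ (by linarith)
    refine ⟨(1 - t) • P + t • Q₀, ⟨hconv hP hQ₀.1 (by linarith) ht0 (by ring), ?_, ?_⟩, ?_⟩
    · intro x hx r
      simp only [Pi.add_apply, Pi.smul_apply, smul_eq_mul, hQ₀.2.1 x hx r]
      ring
    · rw [rewOf_lineMap]
      linarith
    · intro x _ r hP0
      have h3 : 0 < P r x := lt_of_le_of_ne ((hsub hP).1 r x) (Ne.symm hP0)
      have h4 := (hsub hQ₀.1).1 r x
      simp only [Pi.add_apply, Pi.smul_apply, smul_eq_mul]
      nlinarith [mul_pos (sub_pos.2 ht1) h3, mul_nonneg ht0 h4]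
  obtain ⟨Q', hQ', hmax⟩ := hFcomp.exists_isMaxOn ⟨Q₁, hQ₁⟩ hGcont.continuousOn
  have hGQ' : 0 < G Q' := (hGpos Q₁ hQ₁ hQ₁pos).trans_le (hmax hQ₁)
  have hpos : ∀ x ∈ S, ∀ r, P r x ≠ 0 → 0 < Q' r x := by
    intro x hx r hP0
    refine lt_of_le_of_ne ((hsub hQ'.1).1 r x) fun h0 => hGQ'.ne' ?_
    refine Finset.prod_eq_zero hx (Finset.prod_eq_zero (Finset.mem_univ r) ?_)
    rw [← h0, Real.zero_rpow (mul_ne_zero (hη x).ne' hP0)]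
  refine ⟨Q', hQ', hpos, fun Q hQ => ?_⟩
  have hlogG : ∀ Q ∈ F, (∀ x ∈ S, ∀ r, P r x ≠ 0 → 0 < Q r x) →
      Real.log (G Q) = ∑ i ∈ S ×ˢ Finset.univ, η i.1 * P i.2 i.1 * Real.log (Q i.2 i.1) := by
    intro Q _ hQpos
    have hne : ∀ x ∈ S, ∀ r, (Q r x) ^ (η x * P r x) ≠ 0 := by
      intro x hx r
      by_cases hP0 : P r x = 0
      · simp [hP0]
      · exact (Real.rpow_pos_of_pos (hQpos x hx r hP0) _).ne'
    rw [Finset.sum_product,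
      Real.log_prod fun x hx => Finset.prod_ne_zero_iff.2 fun r _ => hne x hx r]
    refine Finset.sum_congr rfl fun x hx => ?_
    rw [Real.log_prod fun r _ => hne x hx r]
    refine Finset.sum_congr rfl fun r _ => ?_
    by_cases hP0 : P r x = 0
    · simp [hP0]
    · rw [Real.log_rpow (hQpos x hx r hP0)]
  have hfirst := sum_mul_div_le_of_isMax (S ×ˢ (Finset.univ : Finset R))
    (fun i => η i.1 * P i.2 i.1) (fun i => Q i.2 i.1) (fun i => Q' i.2 i.1)
    (fun i hi hne => hpos i.1 (Finset.mem_product.1 hi).1 i.2 (right_ne_zero_of_mul hne)) (by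
      filter_upwards [Ioo_mem_nhdsGT (zero_lt_one' ℝ)] with t ht
      have happ : ∀ x r, ((1 - t) • Q' + t • Q) r x = Q' r x + t * (Q r x - Q' r x) := by
        intro x r
        simp only [Pi.add_apply, Pi.smul_apply, smul_eq_mul]
        ring
      have hmem : (1 - t) • Q' + t • Q ∈ F := by
        refine ⟨hconv hQ'.1 hQ.1 (by linarith [ht.2]) ht.1.le (by ring), fun x hx r => ?_, ?_⟩
        · rw [happ, hQ'.2.1 x hx r, hQ.2.1 x hx r]
          ring
        · rw [rewOf_lineMap]
          nlinarith [hQ'.2.2, hQ.2.2, ht.1, ht.2]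
      have htpos : ∀ x ∈ S, ∀ r, P r x ≠ 0 → 0 < ((1 - t) • Q' + t • Q) r x := by
        intro x hx r hP0
        rw [happ]
        nlinarith [mul_pos (sub_pos.2 ht.2) (hpos x hx r hP0),
          mul_nonneg ht.1.le ((hsub hQ.1).1 r x)]
      have hle := Real.log_le_log (hGpos _ hmem htpos) (hmax hmem)
      rw [hlogG _ hmem htpos, hlogG _ hQ' hpos] at hle
      simpa only [happ] using hle)
  rw [Finset.sum_product] at hfirst
  have hterm : ∀ x ∈ S, ∑ r, (η x - η x * P r x / Q' r x) * Q r x =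
      -∑ r, η x * P r x * (Q r x - Q' r x) / Q' r x := by
    intro x hx
    have h1 : ∀ r, (η x - η x * P r x / Q' r x) * Q r x =
        η x * Q r x - η x * P r x - η x * P r x * (Q r x - Q' r x) / Q' r x := by
      intro r
      by_cases hP0 : P r x = 0
      · simp [hP0]
      · have := (hpos x hx r hP0).ne'
        field_simp
        ring
    simp only [h1, Finset.sum_sub_distrib, ← Finset.mul_sum]
    rw [(hsub hQ.1).2 x, (hsub hP).2 x]
    ring
  rw [Finset.sum_congr rfl hterm, Finset.sum_neg_distrib]
  linarith

/-- Strong duality: if the weighted divergence exceeds `1` at all relaxed deceitful distributions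
dominating `P`, then some multiplier has dual value at least `1`. -/
lemma exists_one_le_dualFn {v : R → ℝ} {PP : Set (RMat R X)} (hsub : PP ⊆ POmega)
    (hconv : Convex ℝ PP) (hcomp : IsCompact PP) {P : RMat R X} (hP : P ∈ PP) {η : X → ℝ}
    (hη : ∀ x, 0 < η x) {x' : X} (hx' : x' ∈ deceitArms v PP P) {ε : ℝ} (hε : 0 < ε)
    (hdist : ∀ Q ∈ relaxedDeceit v PP x' P,
      (∀ x ∈ subFinset v P, ∀ r, P r x ≠ 0 → 0 < Q r x) → 1 + ε ≤ realDist v η P Q) :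
    ∃ (α : ℝ) (l : RMat R X), 0 ≤ α ∧ l ∈ dualConeP PP ∧ 1 ≤ dualFn v η x' P α 0 l := by
  obtain ⟨Q', hQ', hpos, hopt⟩ := exists_likelihood_max hsub hconv hcomp hP hη hx'
  have hD := hdist Q' hQ' hpos
  obtain ⟨x₀, hx₀⟩ := optArms_nonempty v P
  set S := subFinset v P with hS
  have hx'S : x' ∈ S := by
    by_contra h
    exact hx'.1 (notMem_subFinset.1 h)
  let h : RMat R X →ₗ[ℝ] ℝ :=
    { toFun := fun Q => rewOf v Q x'
      map_add' := fun Q Q'' => by simp [rewOf, mul_add, Finset.sum_add_distrib]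
      map_smul' := fun c Q => by simp [rewOf, Finset.mul_sum, mul_left_comm] }
  let k : RMat R X →ₗ[ℝ] ℝ :=
    { toFun := fun Q => ∑ x ∈ S, ∑ r, (η x - η x * P r x / Q' r x) * Q r x
      map_add' := fun Q Q'' => by simp [mul_add, Finset.sum_add_distrib]
      map_smul' := fun c Q => by simp [Finset.mul_sum, mul_left_comm] }
  obtain ⟨α, hα, y, hy, hy'⟩ := exists_multipliers hsub hconv hcomp hP S
    (notMem_subFinset.2 hx₀) h k (rewStar v P)
    ⟨Q', hQ'.1, fun x hx => hQ'.2.1 x (notMem_subFinset.1 hx), hQ'.2.2⟩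
    (fun Q hQ hag hb => hopt Q ⟨hQ, fun x hx => hag x (notMem_subFinset.2 hx), hb⟩) hε
  let l : RMat R X := fun r x =>
    if x ∈ S then η x - η x * P r x / Q' r x - α * v r * (if x = x' then 1 else 0) else y r x
  have hlc : ∀ Q : RMat R X, ∑ x ∈ Sᶜ, ∑ r, l r x * Q r x = ∑ x ∈ Sᶜ, ∑ r, y r x * Q r x := by
    intro Q
    refine Finset.sum_congr rfl fun x hx => ?_
    simp [l, Finset.mem_compl.1 hx]
  have hlS : ∀ Q : RMat R X, ∑ x ∈ S, ∑ r, l r x * Q r x = k Q - α * h Q := by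
    intro Q
    have h1 : ∀ x ∈ S, ∑ r, l r x * Q r x =
        ∑ r, (η x - η x * P r x / Q' r x) * Q r x -
          if x = x' then α * rewOf v Q x' else 0 := by
      intro x hx
      simp only [l, hx, if_true, sub_mul _ (α * _ * _), Finset.sum_sub_distrib]
      congr 1
      split_ifs with hxx
      · subst hxx
        simp [rewOf, Finset.mul_sum, mul_assoc]
      · simp
    rw [Finset.sum_congr rfl h1, Finset.sum_sub_distrib]
    rw [Finset.sum_ite_eq' S x', if_pos hx'S]
    rfl
  refine ⟨α, l, hα, ?_, ?_⟩
  · rintro _ ⟨θ, hθ, Q, hQ, rfl⟩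
    have h1 : ∑ x, ∑ r, l r x * (θ • Q) r x = θ * ∑ x, ∑ r, l r x * Q r x := by
      simp [Finset.mul_sum, mul_left_comm]
    rw [h1, ← Finset.sum_compl_add_sum S, hlc, hlS]
    exact mul_nonneg hθ (by linarith [hy Q hQ])
  · have hinner : ∀ x ∈ S, ∀ r, η x - l r x - 0 - α * v r * (if x = x' then 1 else 0) =
        η x * P r x / Q' r x := by
      intro x hx r
      simp only [l, hx, if_true]
      ring
    rw [dualFn, if_pos]
    swap
    · intro x hx r
      rw [hinner x hx r]
      exact div_nonneg (mul_nonneg (hη x).le ((hsub hP).1 r x)) ((hsub hQ'.1).1 r x)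
    have hterm : ∀ x ∈ S, ∀ r, ((η x * P r x : ℝ) : EReal) *
        elog ((η x - l r x - 0 - α * v r * (if x = x' then 1 else 0)) / η x) =
        ((η x * (P r x * Real.log (P r x / Q' r x)) : ℝ) : EReal) := by
      intro x hx r
      rw [hinner x hx r]
      by_cases hP0 : P r x = 0
      · simp [hP0]
      · have h1 : 0 < P r x := lt_of_le_of_ne ((hsub hP).1 r x) (Ne.symm hP0)
        have h2 := hpos x hx r hP0
        have h3 := hη x
        have h4 : η x * P r x / Q' r x / η x = P r x / Q' r x := by field_simp
        rw [h4, elog, if_pos (by positivity), ← EReal.coe_mul, mul_assoc]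
    rw [Finset.sum_congr rfl fun x hx => Finset.sum_congr rfl fun r _ => hterm x hx r]
    simp only [← ereal_coe_sum]
    rw [← EReal.coe_add, optFinset_eq_compl, hlc]
    have hrd : realDist v η P Q' =
        ∑ x ∈ S, ∑ r, η x * (P r x * Real.log (P r x / Q' r x)) := by
      refine Finset.sum_congr rfl fun x _ => ?_
      rw [← Finset.mul_sum, Finset.sum_add_distrib, Finset.sum_sub_distrib, (hsub hP).2 x,
        (hsub hQ'.1).2 x]
      ring
    rw [← hrd]
    exact_mod_cast show (1 : ℝ) ≤ _ by linarith

end Bandits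

/-- dual formulation of the regret lower bound:
for every `P ∈ 𝒫`, `C(P)` equals the infimum of `Σ_{x∈X̃(P)} η(x)·Δ(x,P)` over `η ≥ 0`
and collections `μ(x) = (α(x), β(x), λ(x)) ∈ ℝ₊ × ℝ × 𝒦*` subject to
`1 ≤ Dual(η, x, P; μ(x))` for every deceitful arm `x ∈ X̃_d(P)`. -/
theorem regret_lower_bound_dual
    {R X : Type*} [Fintype R] [Fintype X] [Nonempty X]
    (v : R → ℝ) (hv : ∀ r, 0 ≤ v r)
    (PP : Set (RMat R X)) (hsub : PP ⊆ POmega) (hconv : Convex ℝ PP)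
    (hcomp : IsCompact PP) (hne : (relIntIn POmega PP).Nonempty)
    (P : RMat R X) (hP : P ∈ PP) :
    CFn v PP P =
      sInf {c : EReal | ∃ (η : X → ℝ) (α β : X → ℝ) (l : X → RMat R X),
        (∀ x, 0 ≤ η x) ∧
        (∀ x : X, 0 ≤ α x ∧ l x ∈ dualConeP PP) ∧
        (∀ x ∈ deceitArms v PP P, 1 ≤ dualFn v η x P (α x) (β x) (l x)) ∧
        c = ((∑ x ∈ subFinset v P, η x * gapOf v P x : ℝ) : EReal)} := by
  apply le_antisymm
  · refine le_sInf ?_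
    rintro _ ⟨η, α, β, l, hη, hμ, hdual, rfl⟩
    refine sInf_le ⟨η, hη, fun x hx => le_sInf ?_, rfl⟩
    rintro _ ⟨Q, hQ, rfl⟩
    exact (hdual x (mem_deceitArms_of_mem_deceitSet hcomp hx hQ)).trans
      (dualFn_le_distObj hsub hP hη hx (hμ x).1 (hμ x).2 hQ)
  · refine le_sInf ?_
    rintro _ ⟨η, hη, hdist, rfl⟩
    set C := ∑ x ∈ subFinset v P, η x * gapOf v P x with hC
    set D := ∑ x ∈ subFinset v P, gapOf v P x with hD
    have hlim : Tendsto (fun δ : ℝ => (((1 + δ) * C + δ * D : ℝ) : EReal))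
        (nhdsWithin 0 (Set.Ioi 0)) (nhds (C : EReal)) := by
      have hc : Continuous fun δ : ℝ => (((1 + δ) * C + δ * D : ℝ) : EReal) :=
        continuous_coe_real_ereal.comp (by fun_prop)
      have := hc.tendsto 0
      simp only [add_zero, one_mul, zero_mul] at this
      exact this.mono_left nhdsWithin_le_nhds
    refine ge_of_tendsto hlim ?_
    filter_upwards [self_mem_nhdsWithin] with δ hδ
    have hδ0 : (0 : ℝ) < δ := hδ
    have hη' : ∀ x, 0 < (1 + δ) * η x + δ := fun x => by
      have := hη x
      positivity
    have hex : ∀ x, ∃ (α : ℝ) (l : RMat R X), 0 ≤ α ∧ l ∈ dualConeP PP ∧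
        (x ∈ deceitArms v PP P → 1 ≤ dualFn v (fun x => (1 + δ) * η x + δ) x P α 0 l) := by
      intro x
      by_cases hx : x ∈ deceitArms v PP P
      · obtain ⟨Q₀, hQ₀⟩ := exists_mem_deceitSet hP hx
        obtain ⟨α, l, hα, hl, h1⟩ := exists_one_le_dualFn hsub hconv hcomp hP hη' hx hδ0
          (fun Q hQ hpos => by
            have h1 := one_le_realDist hsub hconv (hdist x hx.1) hQ₀ hQ hpos
            have h2 : realDist v (fun x => (1 + δ) * η x + δ) P Q =
                (1 + δ) * realDist v η P Q + δ * ∑ x ∈ subFinset v P,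
                  ∑ r, (P r x * Real.log (P r x / Q r x) - P r x + Q r x) := by
              rw [realDist, realDist, Finset.mul_sum, Finset.mul_sum, ← Finset.sum_add_distrib]
              exact Finset.sum_congr rfl fun x _ => by ring
            have h3 : 0 ≤ ∑ x ∈ subFinset v P,
                ∑ r, (P r x * Real.log (P r x / Q r x) - P r x + Q r x) :=
              Finset.sum_nonneg fun x hx => Finset.sum_nonneg fun r _ =>
                div_log_nonneg ((hsub hP).1 r x) ((hsub hQ.1).1 r x) fun h0 => by
                  by_contra hP0
                  exact (hpos x hx r hP0).ne' h0
            rw [h2]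
            nlinarith [mul_nonneg hδ0.le h3])
        exact ⟨α, l, hα, hl, fun _ => h1⟩
      · exact ⟨0, 0, le_rfl, fun Q _ => by simp, fun h => absurd h hx⟩
    choose α l hα hl hdual using hex
    refine sInf_le ⟨fun x => (1 + δ) * η x + δ, α, fun _ => 0, l, fun x => (hη' x).le,
      fun x => ⟨hα x, hl x⟩, fun x hx => hdual x hx, ?_⟩
    rw [EReal.coe_eq_coe_iff, hC, hD, Finset.mul_sum, Finset.mul_sum, ← Finset.sum_add_distrib]
    exact Finset.sum_congr rfl fun x _ => by ring

end Bandit
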